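/- arXiv:1403.2991 — 3 statements merged into one kernel-verified Lean document; each statement's English description precedes it below -/
import Mathlib

section
/- If f : ℝⁿ → ℝᴺ is continuous, nonconstant, and has finite weak quasisymmetry constant H_f(ℝⁿ) < ∞, then f is injective. -/
open Metric

/-- A function that is constant on `closedBall a (dist y a)` whenever `f y = f a` is constant as soon
as it takes some value twice. -/
theorem eq_of_eq_on_closedBall {E α : Type*} [NormedAddCommGroup E] [NormedSpace ℝ E] (f : E → α)
    (hf : ∀ x y a : E, f y = f a → dist x a ≤ dist y a → f x = f a)
    {p q : E} (hpq : f q = f p) (hne : q ≠ p) (x : E) : f x = f p := by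
  have hr : 0 < ‖q - p‖ := norm_pos_iff.2 (sub_ne_zero.2 hne)
  set r := ‖q - p‖ with hrdef
  have hstep : ∀ u : E, ‖u‖ = r → ∀ k : ℕ,
      f (p + (k : ℝ) • u) = f p ∧ f (p + (k : ℝ) • u + u) = f p := by
    intro u hu k
    induction k with
    | zero =>
      refine ⟨by simp, ?_⟩
      refine hf _ q p hpq ?_
      simp [dist_eq_norm, hu, hrdef]
    | succ k ih =>
      obtain ⟨h₁, h₂⟩ := ih
      have e : p + ((k + 1 : ℕ) : ℝ) • u = p + (k : ℝ) • u + u := by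
        push_cast; module
      rw [e]
      refine ⟨h₂, (hf _ (p + (k : ℝ) • u) _ (h₁.trans h₂.symm) ?_).trans h₂⟩
      simp [dist_eq_norm]
  rcases eq_or_ne x p with rfl | hx
  · rfl
  have ht : 0 < ‖x - p‖ := norm_pos_iff.2 (sub_ne_zero.2 hx)
  set t := ‖x - p‖ with htdef
  set u : E := (r / t) • (x - p) with hudef
  have hu : ‖u‖ = r := by
    rw [hudef, norm_smul, Real.norm_of_nonneg (by positivity), ← htdef]
    field_simp
  have hxu : x = p + (t / r) • u := by
    rw [hudef, smul_smul, show t / r * (r / t) = 1 by field_simp]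
    simp
  obtain ⟨h₁, h₂⟩ := hstep u hu ⌊t / r⌋₊
  refine (hf x _ _ (h₂.trans h₁.symm) ?_).trans h₁
  have hle := Nat.floor_le (show 0 ≤ t / r by positivity)
  have hlt := Nat.lt_floor_add_one (t / r)
  have e : x - (p + (⌊t / r⌋₊ : ℝ) • u) = (t / r - ⌊t / r⌋₊) • u := by
    conv_lhs => rw [hxu]
    module
  rw [dist_eq_norm, dist_eq_norm, e, norm_smul, Real.norm_of_nonneg (by linarith),
    add_sub_cancel_left]
  exact mul_le_of_le_one_left (norm_nonneg u) (by linarith)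

/-- If `f : ℝⁿ → ℝᴺ` is continuous, nonconstant, and has finite weak
quasisymmetry constant (i.e. there is `H < ∞` such that `|x−a| ≤ |y−a|` implies
`|f x − f a| ≤ H·|f y − f a|` for all `x, y, a`), then `f` is injective. -/
theorem weakly_quasisymmetric_of_continuous_nonconstant_injective
    {n N : ℕ} (f : EuclideanSpace ℝ (Fin n) → EuclideanSpace ℝ (Fin N))
    (hcont : Continuous f)
    (hnonconst : ∃ a b, f a ≠ f b)
    (H : ℝ)
    (hH : ∀ x y a : EuclideanSpace ℝ (Fin n),
      dist x a ≤ dist y a → dist (f x) (f a) ≤ H * dist (f y) (f a)) :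
    Function.Injective f := by
  intro p q hpq
  by_contra hne
  have hf : ∀ x y a, f y = f a → dist x a ≤ dist y a → f x = f a := by
    intro x y a hya hxa
    have h := hH x y a hxa
    rw [hya, dist_self, mul_zero] at h
    exact dist_le_zero.1 h
  have hconst := eq_of_eq_on_closedBall f hf hpq hne
  obtain ⟨a, b, hab⟩ := hnonconst
  exact hab ((hconst a).trans (hconst b).symm)
end

section
/- If N ≥ 2 and f : B(x,r) → ℝᴺ is a weakly 1-quasisymmetric topological embedding of a closed ball in ℝᴺ, then f is the restriction of a similarity of ℝᴺ (a composition of a translation, an orthogonal transformation, and a dilation). -/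
open Metric

open scoped RealInnerProductSpace

section Midpoint

variable {E F : Type*} [NormedAddCommGroup E] [InnerProductSpace ℝ E]
  [NormedAddCommGroup F] [InnerProductSpace ℝ F] [FiniteDimensional ℝ E]

/-- An injective map which sends points equidistant from a centre to points equidistant from the
image of that centre preserves midpoints, if the target has the same dimension as the source. -/
theorem add_eq_two_smul_of_equidistant
    (hEF : Module.finrank ℝ E = Module.finrank ℝ F) {B : Set E} {f : E → F}
    (hinj : Set.InjOn f B)
    (heq : ∀ p ∈ B, ∀ q ∈ B, ∀ a ∈ B, dist p a = dist q a → dist (f p) (f a) = dist (f q) (f a))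
    {a d : E} (hB : closedBall a ‖d‖ ⊆ B) :
    f (a + d) + f (a - d) = (2 : ℝ) • f a := by
  rcases eq_or_ne d 0 with rfl | hd
  · simp [two_smul]
  set ρ := ‖d‖ with hρ
  have hρ0 : 0 < ρ := norm_pos_iff.2 hd
  have hcard : Module.finrank ℝ E = Fintype.card (Fin (Module.finrank ℝ E)) := by simp
  have : Nontrivial E := ⟨d, 0, hd⟩
  let i₀ : Fin (Module.finrank ℝ E) := ⟨0, Module.finrank_pos⟩
  have hv : Orthonormal ℝ (({i₀} : Set (Fin (Module.finrank ℝ E))).domRestrict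
      fun _ => (ρ⁻¹ • d : E)) := by
    constructor
    · intro i
      change ‖ρ⁻¹ • d‖ = 1
      rw [norm_smul, norm_inv, Real.norm_of_nonneg hρ0.le, ← hρ, inv_mul_cancel₀ hρ0.ne']
    · intro i j hij
      exact absurd (Subsingleton.elim i j) hij
  obtain ⟨b, hb⟩ := hv.exists_orthonormalBasis_extension_of_card_eq hcard
  have hbd : ρ • b i₀ = d := by
    rw [hb i₀ rfl, smul_smul, mul_inv_cancel₀ hρ0.ne', one_smul]
  have hbn : ∀ i, ‖ρ • b i‖ = ρ := fun i => by simp [norm_smul, abs_of_pos hρ0]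
  have ha : a ∈ B := hB (by simp [hρ0.le])
  have hp : ∀ i, a + ρ • b i ∈ B := fun i => hB (by simp [hbn])
  have hq : ∀ i, a - ρ • b i ∈ B := fun i => hB (by simp [hbn])
  let P := fun i => f (a + ρ • b i) - f a
  let Q := fun i => f (a - ρ • b i) - f a
  have hPQ : ∀ i j, ‖P i‖ = ‖Q j‖ := fun i j => by
    have := heq _ (hp i) _ (hq j) a ha (by simp [dist_eq_norm, hbn])
    simpa [dist_eq_norm] using this
  have hsq : ∀ i j, i ≠ j → ‖ρ • b i - ρ • b j‖ = ‖ρ • b i + ρ • b j‖ := fun i j hij => by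
    have h0 : ⟪ρ • b i, ρ • b j⟫ = 0 := by
      simp [inner_smul_left, inner_smul_right, b.inner_eq_zero hij]
    rw [← sq_eq_sq₀ (norm_nonneg _) (norm_nonneg _), norm_sub_sq_real, norm_add_sq_real, h0]
    ring
  have hPort : ∀ i j, i ≠ j → ⟪P i, P j - Q j⟫ = 0 := fun i j hij => by
    have h1 := heq _ (hp j) _ (hq j) _ (hp i) (by
      rw [dist_comm, dist_comm (a - _), dist_eq_norm, dist_eq_norm, add_sub_add_left_eq_sub,
        add_sub_sub_cancel]
      exact hsq i j hij)
    have h2 : ‖P i - P j‖ = ‖P i - Q j‖ := by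
      rw [dist_comm, dist_comm (f (a - _)), dist_eq_norm, dist_eq_norm] at h1
      simpa [P, Q] using h1
    have h3 := congrArg (· ^ 2) h2
    simp only [norm_sub_sq_real] at h3
    rw [inner_sub_right]
    rw [← hPQ j j] at h3
    linarith
  have hQort : ∀ i j, i ≠ j → ⟪Q i, P j - Q j⟫ = 0 := fun i j hij => by
    have h1 := heq _ (hp j) _ (hq j) _ (hq i) (by
      rw [dist_eq_norm, dist_comm, dist_eq_norm, add_sub_sub_cancel, sub_sub_sub_cancel_left]
      exact (hsq j i hij.symm).symm)
    have h2 : ‖Q i - P j‖ = ‖Q i - Q j‖ := by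
      rw [dist_comm, dist_comm (f (a - ρ • b j)), dist_eq_norm, dist_eq_norm] at h1
      simpa [P, Q] using h1
    have h3 := congrArg (· ^ 2) h2
    simp only [norm_sub_sq_real] at h3
    rw [inner_sub_right]
    rw [← hPQ j j] at h3
    linarith
  have hW0 : ∀ i, P i - Q i ≠ 0 := fun i h => by
    have h1 : f (a + ρ • b i) = f (a - ρ • b i) := by simpa [P, Q, sub_eq_zero] using h
    have h2 := hinj (hp i) (hq i) h1
    have h3 : (2 : ℝ) • (ρ • b i) = 0 := by
      rw [two_smul]
      calc _ = (a + ρ • b i) - (a - ρ • b i) := by abel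
        _ = 0 := sub_eq_zero.2 h2
    have h4 : ρ • b i = 0 := (smul_eq_zero_iff_right two_ne_zero).1 h3
    have := hbn i
    rw [h4, norm_zero] at this
    exact hρ0.ne this
  have hlin : LinearIndependent ℝ fun i => P i - Q i :=
    linearIndependent_of_ne_zero_of_inner_eq_zero hW0 fun i j hij => by
      change ⟪P i - Q i, P j - Q j⟫ = 0
      rw [inner_sub_left, hPort i j hij, hQort i j hij, sub_zero]
  have : Nonempty (Fin (Module.finrank ℝ E)) := ⟨i₀⟩
  let w := basisOfLinearIndependentOfCardEqFinrank hlin (by simpa using hEF)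
  have hsum : P i₀ + Q i₀ = 0 := InnerProductSpace.ext_inner_right_basis (𝕜 := ℝ) w fun j => by
    rw [coe_basisOfLinearIndependentOfCardEqFinrank, inner_zero_left, inner_add_left]
    rcases eq_or_ne i₀ j with rfl | hij
    · rw [← inner_add_left, real_inner_add_sub_eq_zero_iff]
      exact hPQ _ _
    · rw [hPort _ _ hij, hQort _ _ hij, add_zero]
  simp only [P, Q, hbd] at hsum
  rw [two_smul, ← sub_eq_zero, ← hsum]
  abel

end Midpoint

section Additive

variable {E F : Type*} [NormedAddCommGroup E] [NormedSpace ℝ E]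
  [NormedAddCommGroup F] [NormedSpace ℝ F]

theorem map_nsmul_of_add_on_closedBall {g : E → F} {r : ℝ} (hr : 0 ≤ r)
    (hadd : ∀ h k, ‖h‖ ≤ r → ‖k‖ ≤ r → ‖h + k‖ ≤ r → g (h + k) = g h + g k)
    (n : ℕ) {h : E} (hh : n * ‖h‖ ≤ r) : g ((n : ℝ) • h) = (n : ℝ) • g h := by
  induction n with
  | zero =>
    have := hadd 0 0 (by simpa) (by simpa) (by simpa)
    simpa using this
  | succ n ih =>
    push_cast at hh ⊢
    have h0 := norm_nonneg h
    have hn : 0 ≤ (n : ℝ) * ‖h‖ := by positivity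
    have h1 : n * ‖h‖ ≤ r := by linarith
    rw [add_smul, one_smul, hadd _ _ (by simpa [norm_smul]) (by linarith), ih h1, add_smul,
      one_smul]
    calc ‖(n : ℝ) • h + h‖ ≤ ‖(n : ℝ) • h‖ + ‖h‖ := norm_add_le _ _
      _ ≤ r := by rw [norm_smul, Real.norm_natCast]; linarith

/-- An additive map on a ball whose norm is a monotone function of the norm of the argument scales
norms. -/
theorem mul_norm_le_mul_norm_of_add_on_closedBall {g : E → F} {r : ℝ} (hr : 0 ≤ r)
    (hadd : ∀ h k, ‖h‖ ≤ r → ‖k‖ ≤ r → ‖h + k‖ ≤ r → g (h + k) = g h + g k)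
    (hmono : ∀ h k, ‖h‖ ≤ r → ‖k‖ ≤ r → ‖h‖ ≤ ‖k‖ → ‖g h‖ ≤ ‖g k‖)
    {h k : E} (hh : ‖h‖ ≤ r) (hk : ‖k‖ ≤ r) : ‖h‖ * ‖g k‖ ≤ ‖k‖ * ‖g h‖ := by
  rcases eq_or_ne k 0 with rfl | hk0
  · have := map_nsmul_of_add_on_closedBall hr hadd 0 (h := (0 : E)) (by simpa)
    simp only [Nat.cast_zero, zero_smul] at this
    simp [this]
  have hkp : 0 < ‖k‖ := norm_pos_iff.2 hk0
  have key : ∀ n : ℕ, (n : ℝ) * (‖h‖ * ‖g k‖ - ‖k‖ * ‖g h‖) ≤ ‖k‖ * ‖g k‖ := fun n => by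
    rcases Nat.eq_zero_or_pos n with rfl | hn
    · simp; positivity
    have hn' : (0 : ℝ) < n := by exact_mod_cast hn
    set u : E := (n : ℝ)⁻¹ • k with hu
    have hun : n * ‖u‖ = ‖k‖ := by
      rw [hu, norm_smul, norm_inv, Real.norm_natCast, mul_inv_cancel_left₀ hn'.ne']
    have hup : 0 < ‖u‖ := pos_of_mul_pos_right (hun ▸ hkp) hn'.le
    have hgk : ‖g k‖ = n * ‖g u‖ := by
      have := map_nsmul_of_add_on_closedBall hr hadd n (h := u) (hun.le.trans hk)
      rw [hu, smul_smul, mul_inv_cancel₀ hn'.ne', one_smul, ← hu] at this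
      rw [this, norm_smul, Real.norm_natCast]
    set m := ⌊‖h‖ / ‖u‖⌋₊
    have hm : m * ‖u‖ ≤ ‖h‖ :=
      (le_div_iff₀ hup).1 (Nat.floor_le (by positivity))
    have hm' : ‖h‖ ≤ (m + 1) * ‖u‖ := (div_le_iff₀ hup).1 (Nat.lt_floor_add_one _).le
    have hgh : m * ‖g u‖ ≤ ‖g h‖ := by
      have h1 := map_nsmul_of_add_on_closedBall hr hadd m (h := u) (hm.trans hh)
      have h2 : ‖(m : ℝ) • u‖ = m * ‖u‖ := by rw [norm_smul, Real.norm_natCast]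
      have h3 := hmono ((m : ℝ) • u) h (h2 ▸ hm.trans hh) hh (h2 ▸ hm)
      rwa [h1, norm_smul, Real.norm_natCast] at h3
    have h4 : ‖h‖ * ‖g u‖ ≤ (m + 1) * ‖u‖ * ‖g u‖ := by gcongr
    have h5 : ‖u‖ * (m * ‖g u‖) ≤ ‖u‖ * ‖g h‖ := by gcongr
    rw [← hun, hgk]
    have h6 : 0 ≤ (n : ℝ) * n := by positivity
    nlinarith [mul_le_mul_of_nonneg_left h4 h6, mul_le_mul_of_nonneg_left h5 h6]
  by_contra! hlt
  obtain ⟨n, hn⟩ := exists_nat_gt (‖k‖ * ‖g k‖ / (‖h‖ * ‖g k‖ - ‖k‖ * ‖g h‖))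
  rw [div_lt_iff₀ (sub_pos.2 hlt)] at hn
  exact (key n).not_gt hn

end Additive

/-- A map scaling distances on a ball centred at the origin and fixing the origin extends to a map
scaling all distances. -/
theorem exists_extension_of_norm_sub_eq_mul {E F : Type*} [NormedAddCommGroup E] [NormedSpace ℝ E]
    [NormedAddCommGroup F] [NormedSpace ℝ F] [StrictConvexSpace ℝ F]
    {g : E → F} {r c : ℝ} (hr : 0 < r) (h0 : g 0 = 0)
    (hg : ∀ h k, ‖h‖ ≤ r → ‖k‖ ≤ r → dist (g h) (g k) = c * dist h k) :
    ∃ G : E → F, (∀ p q, dist (G p) (G q) = c * dist p q) ∧ ∀ h, ‖h‖ ≤ r → G h = g h := by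
  have hsmul : ∀ (t : ℝ) (h : E), 0 ≤ t → t ≤ 1 → ‖h‖ ≤ r → g (t • h) = t • g h := by
    intro t h ht ht1 hh
    have hth : ‖t • h‖ ≤ r := by
      rw [norm_smul, Real.norm_of_nonneg ht]
      exact (mul_le_of_le_one_left (norm_nonneg h) ht1).trans hh
    have h00 : ‖(0 : E)‖ ≤ r := by simpa using hr.le
    have := eq_lineMap_of_dist_eq_mul_of_dist_eq_mul (x := (0 : F)) (y := g (t • h)) (z := g h)
      (r := t) (by
        rw [← h0, hg _ _ h00 hth, hg _ _ h00 hh, dist_zero_left, dist_zero_left, norm_smul,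
          Real.norm_of_nonneg ht]
        ring) (by
        rw [← h0, hg _ _ hth hh, hg _ _ h00 hh, dist_zero_left, dist_eq_norm, norm_sub_rev,
          show h - t • h = (1 - t) • h by rw [sub_smul, one_smul], norm_smul,
          Real.norm_of_nonneg (sub_nonneg.2 ht1)]
        ring)
    simpa [AffineMap.lineMap_apply] using this
  let σ := fun v : E => r / (r + ‖v‖)
  have hσ : ∀ v, 0 < σ v := fun v => by positivity
  let G := fun v : E => (σ v)⁻¹ • g (σ v • v)
  have hG : ∀ (s : ℝ) (v : E), 0 < s → ‖s • v‖ ≤ r → G v = s⁻¹ • g (s • v) := by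
    have aux : ∀ (s t : ℝ) (v : E), 0 < s → s ≤ t → ‖t • v‖ ≤ r →
        s⁻¹ • g (s • v) = t⁻¹ • g (t • v) := fun s t v hs hst hv => by
      have ht := hs.trans_le hst
      have h1 := hsmul (s / t) (t • v) (by positivity) ((div_le_one ht).2 hst) hv
      rw [smul_smul, div_mul_cancel₀ _ ht.ne'] at h1
      rw [h1, smul_smul]
      congr 1
      field_simp
    intro s v hs hv
    have hv' : ‖σ v • v‖ ≤ r := by
      rw [norm_smul, Real.norm_of_nonneg (hσ v).le, div_mul_eq_mul_div, div_le_iff₀ (by positivity)]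
      nlinarith [norm_nonneg v]
    rcases le_total (σ v) s with h | h
    · exact aux _ _ v (hσ v) h hv
    · exact (aux _ _ v hs h hv').symm
  refine ⟨G, fun p q => ?_, fun h hh => by simpa using hG 1 h one_pos (by simpa using hh)⟩
  set s := r / (r + ‖p‖ + ‖q‖)
  have hs : 0 < s := by positivity
  have hp : ‖s • p‖ ≤ r := by
    rw [norm_smul, Real.norm_of_nonneg hs.le, div_mul_eq_mul_div, div_le_iff₀ (by positivity)]
    nlinarith [norm_nonneg p, norm_nonneg q]
  have hq : ‖s • q‖ ≤ r := by
    rw [norm_smul, Real.norm_of_nonneg hs.le, div_mul_eq_mul_div, div_le_iff₀ (by positivity)]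
    nlinarith [norm_nonneg p, norm_nonneg q]
  rw [hG s p hs hp, hG s q hs hq, dist_smul₀, hg _ _ hp hq, dist_smul₀, norm_inv,
    Real.norm_of_nonneg hs.le]
  field_simp

/-- If `N ≥ 2` and `f` is a weakly 1-quasisymmetric topological embedding of a
closed ball `B(x,r) ⊂ ℝᴺ` into `ℝᴺ`, then `f` is the restriction of a similarity of `ℝᴺ`
(a map `S` with `|S p − S q| = λ·|p − q|` for a fixed `λ > 0`). -/
theorem weakly_one_quasisymmetric_is_similarity
    {N : ℕ} (hN : 2 ≤ N)
    (x : EuclideanSpace ℝ (Fin N)) (r : ℝ) (hr : 0 < r)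
    (f : EuclideanSpace ℝ (Fin N) → EuclideanSpace ℝ (Fin N))
    (hemb : Topology.IsEmbedding ((Metric.closedBall x r).restrict f))
    (hqs : ∀ p ∈ closedBall x r, ∀ q ∈ closedBall x r, ∀ a ∈ closedBall x r,
      dist p a ≤ dist q a → dist (f p) (f a) ≤ dist (f q) (f a)) :
    ∃ S : EuclideanSpace ℝ (Fin N) → EuclideanSpace ℝ (Fin N),
      (∃ c : ℝ, 0 < c ∧ ∀ p q, dist (S p) (S q) = c * dist p q) ∧
      Set.EqOn f S (closedBall x r) := by
  have hinj : Set.InjOn f (closedBall x r) := Set.injOn_iff_injective.2 hemb.injective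
  have hx : x ∈ closedBall x r := mem_closedBall_self hr.le
  have heq : ∀ p ∈ closedBall x r, ∀ q ∈ closedBall x r, ∀ a ∈ closedBall x r,
      dist p a = dist q a → dist (f p) (f a) = dist (f q) (f a) := fun p hp q hq a ha h =>
    (hqs p hp q hq a ha h.le).antisymm (hqs q hq p hp a ha h.ge)
  have hmem : ∀ h : EuclideanSpace ℝ (Fin N), ‖h‖ ≤ r → x + h ∈ closedBall x r := fun h hh => by
    simpa using hh
  let g := fun h => f (x + h) - f x
  have hg0 : g 0 = 0 := by simp [g]
  have hmid : ∀ m d, ‖m‖ + ‖d‖ ≤ r → g (m + d) + g (m - d) = (2 : ℝ) • g m := fun m d hmd => by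
    have := add_eq_two_smul_of_equidistant rfl hinj heq (a := x + m) (d := d)
      (closedBall_subset_closedBall' (by simpa [add_comm] using hmd))
    simp only [g, smul_sub, ← this, two_smul, add_assoc, add_sub_assoc]
    abel
  have hhalf : ∀ h, ‖h‖ ≤ r → g h = (2 : ℝ) • g ((1 / 2 : ℝ) • h) := fun h hh => by
    have := hmid ((1 / 2 : ℝ) • h) ((1 / 2 : ℝ) • h) (by simp [norm_smul]; linarith)
    rwa [sub_self, hg0, add_zero, ← add_smul, add_halves, one_smul] at this
  have hadd : ∀ h k, ‖h‖ ≤ r → ‖k‖ ≤ r → ‖h + k‖ ≤ r → g (h + k) = g h + g k := by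
    intro h k hh hk hhk
    have hs : ‖h + k‖ ≤ ‖h‖ + ‖k‖ := norm_add_le _ _
    have hd : ‖h - k‖ ≤ ‖h‖ + ‖k‖ := norm_sub_le _ _
    have h1 := hmid ((1 / 4 : ℝ) • (h + k)) ((1 / 4 : ℝ) • (h - k)) (by
      simp only [norm_smul]; norm_num; linarith)
    have e1 : (1 / 4 : ℝ) • (h + k) + (1 / 4 : ℝ) • (h - k) = (1 / 2 : ℝ) • h := by module
    have e2 : (1 / 4 : ℝ) • (h + k) - (1 / 4 : ℝ) • (h - k) = (1 / 2 : ℝ) • k := by module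
    have e3 : (1 / 4 : ℝ) • (h + k) = (1 / 2 : ℝ) • ((1 / 2 : ℝ) • (h + k)) := by module
    rw [e1, e2, e3, ← hhalf _ (by simp only [norm_smul]; norm_num; linarith)] at h1
    rw [hhalf h hh, hhalf k hk, hhalf _ hhk, ← smul_add, h1]
  have hmono : ∀ h k, ‖h‖ ≤ r → ‖k‖ ≤ r → ‖h‖ ≤ ‖k‖ → ‖g h‖ ≤ ‖g k‖ := fun h k hh hk hhk => by
    have := hqs _ (hmem h hh) _ (hmem k hk) x hx (by simpa using hhk)
    simpa [dist_eq_norm] using this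
  let e : EuclideanSpace ℝ (Fin N) := EuclideanSpace.single ⟨0, by omega⟩ r
  have he : ‖e‖ = r := by simp [e, abs_of_pos hr]
  have hge : 0 < ‖g e‖ := norm_pos_iff.2 fun h => by
    have := hinj (hmem e he.le) hx (sub_eq_zero.1 h)
    rw [add_eq_left] at this
    rw [this, norm_zero] at he
    exact hr.ne he
  set c := ‖g e‖ / r
  have hnorm : ∀ h, ‖h‖ ≤ r → ‖g h‖ = c * ‖h‖ := fun h hh => by
    have h1 := mul_norm_le_mul_norm_of_add_on_closedBall hr.le hadd hmono hh he.le
    have h2 := mul_norm_le_mul_norm_of_add_on_closedBall hr.le hadd hmono he.le hh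
    rw [he] at h1 h2
    rw [div_mul_eq_mul_div, eq_div_iff hr.ne']
    linarith
  have hdist : ∀ h k, ‖h‖ ≤ r → ‖k‖ ≤ r → dist (g h) (g k) = c * dist h k := by
    intro h k hh hk
    have hd : ‖(1 / 2 : ℝ) • (h - k)‖ ≤ r := by
      have := norm_sub_le h k
      simp only [norm_smul]; norm_num; linarith
    have h1 := hadd ((1 / 2 : ℝ) • (h - k)) ((1 / 2 : ℝ) • k) hd
      (by simp only [norm_smul]; norm_num; linarith)
      (by rw [← smul_add, sub_add_cancel]; simp only [norm_smul]; norm_num; linarith)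
    rw [← smul_add, sub_add_cancel] at h1
    rw [dist_eq_norm, dist_eq_norm, hhalf h hh, hhalf k hk, h1, smul_add, add_sub_cancel_right,
      norm_smul, hnorm _ hd, norm_smul]
    norm_num
    ring
  obtain ⟨G, hG, hGg⟩ := exists_extension_of_norm_sub_eq_mul hr hg0 hdist
  refine ⟨fun p => f x + G (p - x), ⟨c, by positivity, fun p q => ?_⟩, fun p hp => ?_⟩
  · rw [dist_add_left, hG, dist_sub_right]
  · simp only [hGg (p - x) (by simpa [dist_eq_norm] using hp), g]
    simp
end

section
/- Let V = {v₀,…,vₙ} ⊂ ℝⁿ and let A, B : ℝⁿ → ℝᴺ be affine maps with |A(v) − B(v)| ≤ ε·diam V for all v ∈ V. Then for every z ∈ ℝⁿ, |A(z) − B(z)| ≤ ε·( diam V + (4 n^{(n+1)/2}/n!)·Ψ(V)·dist(z, V) ), where Ψ(V) = (diam V)ⁿ / Lⁿ(conv V) (interpreted as +∞ if the convex hull has measure zero, in which case the statement is vacuous). -/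
open Metric MeasureTheory

/-- Reflecting the part of the corner simplex in the open positive orthant into another orthant
preserves its volume. -/
theorem volume_pos_corner_simplex_eq (ι : Type*) [Fintype ι] (s : ι → Bool) :
    volume {x : ι → ℝ | (∀ i, 0 < if s i then x i else -x i) ∧ ∑ i, |x i| ≤ 1} =
      volume {x : ι → ℝ | (∀ i, 0 < x i) ∧ ∑ i, |x i| ≤ 1} := by
  have hf : MeasurePreserving (fun (x : ι → ℝ) i => if s i then x i else -x i) := by
    have := volume_preserving_pi (f := fun i (t : ℝ) => if s i then t else -t) (fun i => by
      cases s i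
      · simpa using Measure.measurePreserving_neg (volume : Measure ℝ)
      · simpa [Function.id_def] using MeasurePreserving.id (volume : Measure ℝ))
    exact this
  have hm : MeasurableSet {x : ι → ℝ | (∀ i, 0 < x i) ∧ ∑ i, |x i| ≤ 1} := by
    measurability
  rw [← hf.measure_preimage hm.nullMeasurableSet]
  congr 1
  ext x
  have : ∀ i, |if s i then x i else -x i| = |x i| := fun i => by split_ifs <;> simp
  simp [this]

/-- The corner simplex `{x | 0 ≤ x, ∑ x i ≤ 1}` has volume at most `1 / n!`: its `2 ^ n` reflections
are essentially disjoint subsets of the `ℓ¹` unit ball, of volume `2 ^ n / n!`. -/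
theorem volume_corner_simplex_le (ι : Type*) [Fintype ι] [Nonempty ι] :
    volume {x : ι → ℝ | (∀ i, 0 ≤ x i) ∧ ∑ i, x i ≤ 1} ≤
      ENNReal.ofReal (1 / (Fintype.card ι).factorial) := by
  classical
  set P := {x : ι → ℝ | (∀ i, 0 < x i) ∧ ∑ i, |x i| ≤ 1} with hP
  have hsub : {x : ι → ℝ | (∀ i, 0 ≤ x i) ∧ ∑ i, x i ≤ 1} ⊆ P ∪ ⋃ i, {x | x i = 0} := by
    rintro x ⟨h0, h1⟩
    by_cases h : ∃ i, x i = 0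
    · exact Or.inr (by simpa using h)
    · push Not at h
      refine Or.inl ⟨fun i => lt_of_le_of_ne (h0 i) (h i).symm, ?_⟩
      simpa only [abs_of_nonneg (h0 _)] using h1
  have hnull : volume (⋃ i, {x : ι → ℝ | x i = 0}) = 0 := by
    rw [measure_iUnion_null_iff]
    exact fun i => Measure.pi_hyperplane _ i 0
  have hle : (2 : ENNReal) ^ Fintype.card ι * volume P ≤
      ENNReal.ofReal (2 ^ Fintype.card ι / (Fintype.card ι).factorial) := by
    have hball := volume_sum_rpow_le ι le_rfl 1
    simp only [Real.rpow_one, div_one] at hball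
    norm_num [Real.Gamma_nat_eq_factorial] at hball
    rw [← hball]
    calc (2 : ENNReal) ^ Fintype.card ι * volume P
        = ∑ s : ι → Bool,
          volume {x : ι → ℝ | (∀ i, 0 < if s i then x i else -x i) ∧ ∑ i, |x i| ≤ 1} := by
          simp [volume_pos_corner_simplex_eq, hP]
      _ = volume (⋃ s ∈ (Finset.univ : Finset (ι → Bool)),
          {x : ι → ℝ | (∀ i, 0 < if s i then x i else -x i) ∧ ∑ i, |x i| ≤ 1}) := by
          rw [measure_biUnion_finset]
          · intro s _ t _ hst
            obtain ⟨i, hi⟩ := Function.ne_iff.1 hst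
            refine Set.disjoint_left.2 fun x hx hy => ?_
            have h1 := hx.1 i
            have h2 := hy.1 i
            cases hs : s i <;> cases ht : t i <;> simp_all <;> linarith
          · intro s _
            rw [Set.ofPred_and, Set.ofPred_forall]
            refine (MeasurableSet.iInter fun i => measurableSet_lt measurable_const ?_).inter
              (measurableSet_le (by fun_prop) measurable_const)
            cases s i <;> simp <;> fun_prop
      _ ≤ _ := measure_mono (by
          intro x hx
          simp only [Set.mem_iUnion] at hx
          obtain ⟨s, _, hx⟩ := hx
          exact hx.2)
  calc _ ≤ volume P + volume (⋃ i, {x : ι → ℝ | x i = 0}) :=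
        (measure_mono hsub).trans (measure_union_le _ _)
    _ = volume P := by rw [hnull, add_zero]
    _ ≤ _ := by
      have h2 : ENNReal.ofReal (2 ^ Fintype.card ι / (Fintype.card ι).factorial) =
          2 ^ Fintype.card ι * ENNReal.ofReal (1 / (Fintype.card ι).factorial) := by
        rw [div_eq_mul_one_div, ENNReal.ofReal_mul (by positivity), ENNReal.ofReal_pow (by simp)]
        simp
      rw [h2] at hle
      exact (ENNReal.mul_le_mul_iff_right (by simp) (by simp)).1 hle

/-- Hadamard's inequality. -/
theorem OrthonormalBasis.abs_det_le_prod_norm {n : ℕ} {E : Type*} [NormedAddCommGroup E]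
    [InnerProductSpace ℝ E] (b : OrthonormalBasis (Fin n) ℝ E) (u : Fin n → E) :
    |b.toBasis.det u| ≤ ∏ i, ‖u i‖ := by
  have : Fact (Module.finrank ℝ E = n) := ⟨by simpa using Module.finrank_eq_card_basis b.toBasis⟩
  rw [← b.toBasis.orientation.volumeForm_robust' b]
  exact Orientation.abs_volumeForm_apply_le _ u

/-- Cramer's rule. -/
theorem Module.Basis.det_update_map {ι R M : Type*} [Fintype ι] [DecidableEq ι] [CommRing R]
    [AddCommGroup M] [Module R M] (b : Module.Basis ι R M) (f : M →ₗ[R] M) (x : M) (i : ι) :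
    b.det (Function.update (f ∘ b) i (f x)) = LinearMap.det f * b.repr x i := by
  have h : Function.update (f ∘ b) i (f x) = f ∘ Function.update b i x := by
    rw [Function.comp_update]
  rw [h, Module.Basis.det_comp, Module.Basis.det_apply, Module.Basis.toMatrix_update,
    Module.Basis.toMatrix_self, ← Matrix.cramer_apply]
  simp

/-- The volume of a simplex is at most `|det T| / n!`, where `T` maps the standard basis to the
edges issuing from the vertex `v 0`. -/
theorem volume_convexHull_range_le {n : ℕ} (hn : 0 < n)
    (v : Fin (n + 1) → EuclideanSpace ℝ (Fin n))
    (T : EuclideanSpace ℝ (Fin n) →ₗ[ℝ] EuclideanSpace ℝ (Fin n))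
    (hT : ∀ i : Fin n, T (EuclideanSpace.basisFun (Fin n) ℝ i) = v i.succ - v 0) :
    volume (convexHull ℝ (Set.range v)) ≤ ENNReal.ofReal (|LinearMap.det T| / n.factorial) := by
  have : Nonempty (Fin n) := ⟨⟨0, hn⟩⟩
  set S := {x : Fin n → ℝ | (∀ i, 0 ≤ x i) ∧ ∑ i, x i ≤ 1} with hS
  have hSconv : Convex ℝ S := by
    rintro x ⟨hx0, hx1⟩ y ⟨hy0, hy1⟩ a b ha hb hab
    refine ⟨fun i => ?_, ?_⟩
    · have h1 := mul_nonneg ha (hx0 i)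
      have h2 := mul_nonneg hb (hy0 i)
      simpa using add_nonneg h1 h2
    · simp only [Pi.add_apply, Pi.smul_apply, smul_eq_mul, Finset.sum_add_distrib,
        ← Finset.mul_sum]
      nlinarith
  have hSm : MeasurableSet S := by
    rw [hS, Set.ofPred_and, Set.ofPred_forall]
    exact (MeasurableSet.iInter fun i => measurableSet_le measurable_const (by fun_prop)).inter
      (measurableSet_le (by fun_prop) measurable_const)
  set S' : Set (EuclideanSpace ℝ (Fin n)) := WithLp.ofLp ⁻¹' S with hS'
  have hS'conv : Convex ℝ S' :=
    hSconv.linear_preimage (WithLp.linearEquiv 2 ℝ (Fin n → ℝ)).toLinearMap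
  have hvolS : volume S' ≤ ENNReal.ofReal (1 / n.factorial) := by
    rw [hS', (PiLp.volume_preserving_ofLp (Fin n)).measure_preimage hSm.nullMeasurableSet]
    simpa using volume_corner_simplex_le (Fin n)
  have hsub : convexHull ℝ (Set.range v) ⊆ (fun y => v 0 + y) '' (T '' S') := by
    refine convexHull_min ?_ ((hS'conv.linear_image T).translate (v 0))
    rintro _ ⟨i, rfl⟩
    refine Fin.cases ?_ (fun j => ?_) i
    · exact ⟨0, ⟨0, ⟨by simp, by simp⟩, by simp⟩, by simp⟩
    · refine ⟨v j.succ - v 0, ⟨_, ⟨fun k => ?_, ?_⟩, hT j⟩, by simp⟩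
      · simp only [EuclideanSpace.basisFun_apply, PiLp.single_apply]
        split_ifs <;> simp
      · simp
  calc _ ≤ volume ((fun y => v 0 + y) '' (T '' S')) := measure_mono hsub
    _ = ENNReal.ofReal |LinearMap.det T| * volume S' := by
      rw [Set.image_add_left, measure_preimage_add, Measure.addHaar_image_linearMap]
    _ ≤ ENNReal.ofReal |LinearMap.det T| * ENNReal.ofReal (1 / n.factorial) := by gcongr
    _ = _ := by rw [← ENNReal.ofReal_mul (abs_nonneg _), mul_one_div]

/-- Coordinate bound obtained from Cramer's rule and Hadamard's inequality. -/
theorem abs_det_mul_abs_coord_le {n : ℕ} {E : Type*} [NormedAddCommGroup E]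
    [InnerProductSpace ℝ E] (b : OrthonormalBasis (Fin n) ℝ E) (T : E →ₗ[ℝ] E) {d : ℝ}
    (hd : ∀ i, ‖T (b i)‖ ≤ d) (x : E) (i : Fin n) :
    |LinearMap.det T| * |b.repr x i| ≤ ‖T x‖ * d ^ (n - 1) := by
  have h := b.toBasis.det_update_map T x i
  have h' := b.abs_det_le_prod_norm (Function.update (T ∘ b.toBasis) i (T x))
  rw [h, abs_mul, OrthonormalBasis.coe_toBasis_repr_apply] at h'
  refine h'.trans ?_
  rw [← Finset.mul_prod_erase _ _ (Finset.mem_univ i), Function.update_self]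
  gcongr
  calc _ ≤ ∏ _j ∈ Finset.univ.erase i, d := by
        refine Finset.prod_le_prod (fun _ _ => norm_nonneg _) fun j hj => ?_
        rw [Function.update_of_ne (Finset.ne_of_mem_erase hj)]
        simpa using hd j
    _ = d ^ (n - 1) := by simp

/-- Let `V = {v₀,…,vₙ} ⊂ ℝⁿ` and let `A, B : ℝⁿ → ℝᴺ` be affine maps with
`|A v − B v| ≤ ε·diam V` for all `v ∈ V`. If the convex hull of `V` has positive Lebesgue
measure (otherwise `Ψ(V) = ∞` and the claim is vacuous), then for every `z ∈ ℝⁿ`,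
`|A z − B z| ≤ ε·(diam V + (4 n^{(n+1)/2}/n!)·Ψ(V)·dist(z,V))`, where
`Ψ(V) = (diam V)ⁿ / Lⁿ(conv V)`. -/
theorem affine_maps_close_on_simplex (n N : ℕ)
    (v : Fin (n + 1) → EuclideanSpace ℝ (Fin n))
    (A B : (EuclideanSpace ℝ (Fin n)) →ᵃ[ℝ] (EuclideanSpace ℝ (Fin N)))
    (ε : ℝ)
    (hAB : ∀ i, dist (A (v i)) (B (v i)) ≤ ε * Metric.diam (Set.range v))
    (hvol : 0 < volume (convexHull ℝ (Set.range v))) :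
    ∀ z : EuclideanSpace ℝ (Fin n),
      dist (A z) (B z) ≤ ε * (Metric.diam (Set.range v) +
        (4 * (n : ℝ) ^ (((n : ℝ) + 1) / 2) / (n.factorial : ℝ)) *
          ((Metric.diam (Set.range v)) ^ n / (volume (convexHull ℝ (Set.range v))).toReal) *
          Metric.infDist z (Set.range v)) := by
  intro z
  set d := Metric.diam (Set.range v) with hd
  obtain rfl | hn := Nat.eq_zero_or_pos n
  · have hz : z = v 0 := Subsingleton.elim _ _
    have hz' : Metric.infDist z (Set.range v) = 0 :=
      Metric.infDist_zero_of_mem ⟨0, hz.symm⟩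
    rw [hz', mul_zero, add_zero, hz]
    exact hAB 0
  have hfin : (Set.range v).Finite := Set.finite_range v
  have hdist : ∀ i j, ‖v i - v j‖ ≤ d := fun i j => by
    rw [← dist_eq_norm]
    exact Metric.dist_le_diam_of_mem hfin.isBounded ⟨i, rfl⟩ ⟨j, rfl⟩
  have hd0 : 0 ≤ d := Metric.diam_nonneg
  set b := EuclideanSpace.basisFun (Fin n) ℝ with hb
  set T : EuclideanSpace ℝ (Fin n) →ₗ[ℝ] EuclideanSpace ℝ (Fin n) :=
    b.toBasis.constr ℝ fun i => v i.succ - v 0 with hTdef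
  have hT : ∀ i, T (b i) = v i.succ - v 0 := fun i => by
    rw [hTdef, ← b.coe_toBasis]
    exact b.toBasis.constr_basis ℝ _ i
  have hV := volume_convexHull_range_le hn v T hT
  set V := (volume (convexHull ℝ (Set.range v))).toReal with hVdef
  have hVpos : 0 < V :=
    ENNReal.toReal_pos hvol.ne' (ne_top_of_le_ne_top ENNReal.ofReal_ne_top hV)
  have hVle : V ≤ |LinearMap.det T| / n.factorial :=
    ENNReal.toReal_le_of_le_ofReal (by positivity) hV
  have hfact : (0 : ℝ) < n.factorial := by exact_mod_cast n.factorial_pos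
  have hdet : 0 < |LinearMap.det T| := by
    by_contra! h
    have : |LinearMap.det T| / n.factorial ≤ 0 := div_nonpos_of_nonpos_of_nonneg h hfact.le
    linarith
  have hsurj : Function.Surjective T :=
    (LinearMap.equivOfDetNeZero T (abs_pos.1 hdet)).surjective
  obtain ⟨k, hk⟩ : ∃ k, Metric.infDist z (Set.range v) = dist z (v k) := by
    obtain ⟨_, ⟨k, rfl⟩, hk⟩ := hfin.isCompact.exists_infDist_eq_dist (Set.range_nonempty v) z
    exact ⟨k, hk⟩
  have hεd : 0 ≤ ε * d := dist_nonneg.trans (hAB 0)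
  obtain ⟨x, hx⟩ := hsurj (z - v k)
  set L := A.linear - B.linear with hL
  have hdiff : ∀ p q, L (p - q) = (A p - B p) - (A q - B q) := fun p q => by
    have hA := A.linearMap_vsub p q
    have hB := B.linearMap_vsub p q
    simp only [vsub_eq_sub] at hA hB
    simp only [hL, LinearMap.sub_apply, hA, hB]
    abel
  have hLT : ∀ i, ‖L (T (b i))‖ ≤ 2 * (ε * d) := fun i => by
    rw [hT, hdiff]
    refine (norm_sub_le _ _).trans ?_
    have h1 := hAB i.succ
    have h2 := hAB 0
    rw [dist_eq_norm] at h1 h2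
    linarith
  set D := |LinearMap.det T| with hD
  set δ := Metric.infDist z (Set.range v) with hδ
  have hcoord : ∀ i, |b.repr x i| ≤ δ * d ^ (n - 1) / D := fun i => by
    rw [le_div_iff₀ hdet, mul_comm, hk, dist_eq_norm, ← hx]
    exact abs_det_mul_abs_coord_le b T (fun i => (hT i) ▸ hdist _ _) x i
  have hLz : ‖L (z - v k)‖ ≤ n * (δ * d ^ (n - 1) / D * (2 * (ε * d))) := by
    rw [← hx, ← b.sum_repr x, map_sum, map_sum]
    refine (norm_sum_le _ _).trans ?_
    calc _ ≤ ∑ _i : Fin n, δ * d ^ (n - 1) / D * (2 * (ε * d)) := by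
          refine Finset.sum_le_sum fun i _ => ?_
          rw [map_smul, map_smul, norm_smul, Real.norm_eq_abs]
          have := hcoord i
          gcongr
          · exact (abs_nonneg _).trans this
          · exact hLT i
      _ = _ := by simp
  have hδ0 : 0 ≤ δ := Metric.infDist_nonneg
  have hpow : (n : ℝ) ≤ (n : ℝ) ^ (((n : ℝ) + 1) / 2) := by
    have h1 : (1 : ℝ) ≤ n := by exact_mod_cast hn
    exact Real.self_le_rpow_of_one_le h1 (by linarith)
  have hdn : d ^ (n - 1) * d = d ^ n := by rw [← pow_succ, Nat.sub_add_cancel hn]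
  have hε : 0 ≤ ε * d ^ n := by
    rw [← hdn, mul_comm (d ^ (n - 1)), ← mul_assoc]
    positivity
  have hinv : 1 / D ≤ 1 / (n.factorial * V) := by
    apply one_div_le_one_div_of_le (by positivity)
    rwa [le_div_iff₀ hfact, mul_comm] at hVle
  have hz : A z - B z = (A (v k) - B (v k)) + L (z - v k) := by rw [hdiff]; abel
  calc dist (A z) (B z) ≤ ‖A (v k) - B (v k)‖ + ‖L (z - v k)‖ := by
        rw [dist_eq_norm, hz]; exact norm_add_le _ _
    _ ≤ ε * d + n * (δ * d ^ (n - 1) / D * (2 * (ε * d))) := by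
        rw [← dist_eq_norm]; exact add_le_add (hAB k) hLz
    _ = ε * d + 2 * n * (1 / D) * ((ε * d ^ n) * δ) := by rw [← hdn]; ring
    _ ≤ ε * d + 4 * (n : ℝ) ^ (((n : ℝ) + 1) / 2) * (1 / (n.factorial * V)) *
          ((ε * d ^ n) * δ) := by
        gcongr
        norm_num
    _ = _ := by field_simp
end
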